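/- Let f : ℂ → ℂ be entire of exponential type τ > 0 with f|ℝ Lebesgue integrable on ℝ, and let a > τ be real. Then ∫_{−∞}^{∞} f(x)·e^{iax} dx = 0. -/

import Mathlib

open MeasureTheory

open Complex Filter Topology in
/-- Phragmen-Lindelof in the upper half-plane. -/
theorem aux_upper {F : ℂ → ℂ} (hF : Differentiable ℂ F) {a C M : ℝ}
    (hC : ∀ z, ‖F z‖ ≤ C * Real.exp (a * ‖z‖)) (hM : ∀ x : ℝ, ‖F x‖ ≤ M)
    (z : ℂ) (hz : 0 ≤ z.im) : ‖F z‖ ≤ M * Real.exp (a * z.im) := by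
  have hn : ∀ w : ℂ, ‖F (I * w) * exp (-(a * w))‖ = ‖F (I * w)‖ * Real.exp (-(a * w.re)) := by
    intro w
    rw [norm_mul, Complex.norm_exp]
    simp
  have key : ∀ w : ℂ, 0 ≤ w.re → ‖F (I * w) * exp (-(a * w))‖ ≤ M := by
    intro w hw
    refine PhragmenLindelof.right_half_plane_of_bounded_on_real
      (f := fun w => F (I * w) * exp (-(a * w))) ?_ ?_ ?_ ?_ hw
    · exact Differentiable.diffContOnCl (by fun_prop)
    · refine ⟨1, by norm_num, a + |a|, ?_⟩
      refine Asymptotics.IsBigO.of_bound C (Eventually.of_forall fun w => ?_)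
      rw [hn, Real.norm_eq_abs, Real.abs_exp, Real.rpow_one]
      have h1 := hC (I * w)
      have h2 : -(a * w.re) ≤ |a| * ‖w‖ := by
        calc -(a * w.re) ≤ |a * w.re| := neg_le_abs _
          _ = |a| * |w.re| := abs_mul _ _
          _ ≤ _ := by gcongr; exact Complex.abs_re_le_norm w
      rw [norm_mul, norm_I, one_mul] at h1
      calc _ ≤ (C * Real.exp (a * ‖w‖)) * Real.exp (|a| * ‖w‖) := by
            gcongr
            exact (norm_nonneg _).trans h1
        _ = _ := by rw [mul_assoc, ← Real.exp_add]; ring_nf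
    · refine isBoundedUnder_of_eventually_le (a := C) ?_
      filter_upwards [eventually_ge_atTop 0] with x hx
      rw [hn]
      have h1 := hC (I * x)
      rw [norm_mul, norm_I, one_mul, Complex.norm_real, Real.norm_eq_abs, abs_of_nonneg hx] at h1
      calc _ ≤ (C * Real.exp (a * x)) * Real.exp (-(a * x)) := by
            rw [ofReal_re]; gcongr
        _ = C := by rw [mul_assoc, ← Real.exp_add]; simp
    · intro x
      rw [hn]
      have : I * (x * I) = ((-x : ℝ) : ℂ) := by
        push_cast; linear_combination (x : ℂ) * I_mul_I
      rw [this]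
      simpa using hM (-x)
  have h := key (-I * z) (by simpa using hz)
  rw [hn] at h
  have e : I * (-I * z) = z := by linear_combination -z * I_mul_I
  rw [e] at h
  have e2 : (-I * z).re = z.im := by simp
  rw [e2] at h
  calc ‖F z‖ = (‖F z‖ * Real.exp (-(a * z.im))) * Real.exp (a * z.im) := by
        rw [mul_assoc, ← Real.exp_add]; simp
    _ ≤ _ := by gcongr

open Complex Filter Topology in
/-- Two-sided version. -/
theorem aux_both {F : ℂ → ℂ} (hF : Differentiable ℂ F) {a C M : ℝ}
    (hC : ∀ z, ‖F z‖ ≤ C * Real.exp (a * ‖z‖)) (hM : ∀ x : ℝ, ‖F x‖ ≤ M)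
    (z : ℂ) : ‖F z‖ ≤ M * Real.exp (a * |z.im|) := by
  rcases le_total 0 z.im with h | h
  · rw [abs_of_nonneg h]; exact aux_upper hF hC hM z h
  · rw [abs_of_nonpos h]
    have := aux_upper (F := fun z => F (-z)) (hF.comp differentiable_neg) (a := a) (C := C) (M := M)
      (fun z => by simpa using hC (-z)) (fun x => by simpa using hM (-x)) (-z) (by simpa using h)
    simpa using this

open Complex Filter Topology in
/-- The function `f` is bounded by a multiple of `exp (a * Im z)` in the upper half-plane. -/
theorem aux_bound (f : ℂ → ℂ) (τ : ℝ) (hτ : 0 < τ)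
    (hf : Differentiable ℂ f)
    (htype : ∀ ε > 0, ∃ C > 0, ∀ z : ℂ, ‖f z‖ ≤ C * Real.exp ((τ + ε) * ‖z‖))
    (hint : Integrable (fun x : ℝ => f x))
    (a : ℝ) (ha : τ < a) :
    ∃ M, 0 ≤ M ∧ ∀ z : ℂ, 0 ≤ z.im → ‖f z‖ ≤ M * Real.exp (a * z.im) := by
  obtain ⟨F, hF0, hF⟩ : ∃ F : ℂ → ℂ, F 0 = 0 ∧ ∀ z, HasDerivAt F (f z) z := by
    obtain ⟨F, hF⟩ := hf.isExactOn_univ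
    exact ⟨fun z => F z - F 0, by simp, fun z => (hF z (Set.mem_univ z)).sub_const _⟩
  have hFd : Differentiable ℂ F := fun z => (hF z).differentiableAt
  have hε : 0 < (a - τ) / 2 := by linarith
  obtain ⟨C, hC0, hC⟩ := htype _ hε
  set ε := (a - τ) / 2 with hεd
  have hgrow : ∀ z, ‖F z‖ ≤ (C / ε) * Real.exp (a * ‖z‖) := by
    intro z
    have h := (convex_closedBall (0:ℂ) ‖z‖).norm_image_sub_le_of_norm_hasDerivWithin_le (f := F)
      (f' := f) (C := C * Real.exp ((τ + ε) * ‖z‖)) (x := 0) (y := z)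
      (fun x _ => (hF x).hasDerivWithinAt) (fun x hx => (hC x).trans (by
        have : ‖x‖ ≤ ‖z‖ := by simpa using hx
        gcongr)) (by simp) (by simp)
    rw [hF0, sub_zero, sub_zero] at h
    have h3 : ‖z‖ ≤ Real.exp (ε * ‖z‖) / ε := by
      rw [le_div_iff₀ hε]
      linarith [Real.add_one_le_exp (ε * ‖z‖)]
    calc _ ≤ _ := h
      _ ≤ C * Real.exp ((τ + ε) * ‖z‖) * (Real.exp (ε * ‖z‖) / ε) := by gcongr
      _ = C / ε * (Real.exp ((τ + ε) * ‖z‖) * Real.exp (ε * ‖z‖)) := by ring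
      _ = _ := by
        rw [← Real.exp_add]
        congr 2
        rw [hεd]; ring
  have hreal : ∀ x : ℝ, ‖F x‖ ≤ ∫ x : ℝ, ‖f x‖ := by
    intro x
    have h := intervalIntegral.integral_eq_sub_of_hasDerivAt (a := 0) (b := x)
      (f := fun x : ℝ => F x) (f' := fun x : ℝ => f x)
      (fun y _ => (hF y).comp_ofReal) hint.intervalIntegrable
    simp only [ofReal_zero, hF0, sub_zero] at h
    rw [← h]
    refine intervalIntegral.norm_integral_le_integral_norm_uIoc.trans ?_
    exact setIntegral_le_integral hint.norm (Eventually.of_forall fun _ => norm_nonneg _)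
  set N := ∫ x : ℝ, ‖f x‖ with hN
  have hN0 : 0 ≤ N := integral_nonneg fun _ => norm_nonneg _
  have hb := aux_both hFd hgrow hreal
  have ha0 : 0 < a := hτ.trans ha
  refine ⟨N * Real.exp a, by positivity, fun z hz => ?_⟩
  have h := norm_deriv_le_of_forall_mem_sphere_norm_le (c := z) (R := 1)
    (C := N * Real.exp (a * (z.im + 1))) one_pos hFd.diffContOnCl (fun w hw => by
      refine (hb w).trans ?_
      have h1 : ‖w - z‖ = 1 := by simpa [dist_eq_norm] using hw
      have h2 : |w.im - z.im| ≤ 1 := by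
        rw [← h1, ← sub_im]; exact Complex.abs_im_le_norm _
      have h3 : |w.im| ≤ z.im + 1 := by
        rw [abs_le] at h2 ⊢
        constructor <;> linarith
      gcongr)
  rw [(hF z).deriv, div_one] at h
  rw [mul_assoc, ← Real.exp_add]
  convert h using 3
  ring

open Complex in
theorem aux_normSq {δ : ℝ} (z : ℂ) : 
    ‖1 - I * δ * z‖ ^ 2 = (1 + δ * z.im) ^ 2 + (δ * z.re) ^ 2 := by
  rw [← Complex.normSq_eq_norm_sq, Complex.normSq_apply]
  simp
  ring

open Complex Filter Topology in
theorem aux_delta (f : ℂ → ℂ) (hf : Differentiable ℂ f)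
    (hint : Integrable (fun x : ℝ => f x)) (a M : ℝ) (hM : 0 ≤ M)
    (hb : ∀ z : ℂ, 0 ≤ z.im → ‖f z‖ ≤ M * Real.exp (a * z.im)) (δ : ℝ) (hδ : 0 < δ) :
    ∫ x : ℝ, f x * exp (I * a * x) / (1 - I * δ * x) ^ 2 = 0 := by
  set g : ℂ → ℂ := fun z => f z * exp (I * a * z) / (1 - I * δ * z) ^ 2 with hg
  have hge1 : ∀ z : ℂ, 0 ≤ z.im → 1 ≤ ‖1 - I * δ * z‖ ^ 2 := by
    intro z hz
    rw [aux_normSq]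
    have : 0 ≤ δ * z.im := by positivity
    nlinarith [sq_nonneg (δ * z.re)]
  have hne : ∀ z : ℂ, 0 ≤ z.im → 1 - I * δ * z ≠ 0 := by
    intro z hz h0
    have := hge1 z hz
    rw [h0] at this
    norm_num at this
  have hgd : ∀ z : ℂ, 0 ≤ z.im → DifferentiableAt ℂ g z := by
    intro z hz
    refine DifferentiableAt.div ?_ ?_ (pow_ne_zero 2 (hne z hz))
    · exact (hf z).mul (by fun_prop)
    · fun_prop
  have hgb : ∀ R > 0, ∀ z : ℂ, 0 ≤ z.im → (R ≤ |z.re| ∨ R ≤ z.im) → ‖g z‖ ≤ M / (δ * R) ^ 2 := by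
    intro R hR z hz h
    have h1 : (δ * R) ^ 2 ≤ ‖1 - I * δ * z‖ ^ 2 := by
      rw [aux_normSq]
      have h0 : 0 ≤ δ * z.im := by positivity
      rcases h with h | h
      · have : (δ * R) ^ 2 ≤ (δ * z.re) ^ 2 := by
          rw [sq_le_sq, abs_mul, abs_mul, abs_of_pos hR]
          gcongr
        nlinarith
      · have : (δ * R) ≤ δ * z.im := by gcongr
        have h2 : 0 < δ * R := by positivity
        nlinarith [sq_nonneg (δ * z.re)]
    have h2 : ‖f z * exp (I * a * z)‖ ≤ M := by
      rw [norm_mul, Complex.norm_exp]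
      have e : (I * a * z).re = -(a * z.im) := by simp
      rw [e]
      calc _ ≤ (M * Real.exp (a * z.im)) * Real.exp (-(a * z.im)) := by
            gcongr; exact hb z hz
        _ = M := by rw [mul_assoc, ← Real.exp_add]; simp
    rw [hg]
    simp only [norm_div, norm_pow]
    gcongr
  have hgi : Integrable (fun x : ℝ => g x) := by
    refine hint.norm.mono' ?_ (Eventually.of_forall fun x => ?_)
    · refine Continuous.aestronglyMeasurable ?_
      rw [continuous_iff_continuousAt]
      intro x
      exact ContinuousAt.comp (f := fun x : ℝ => (x : ℂ)) (hgd x (by simp)).continuousAt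
        Complex.continuous_ofReal.continuousAt
    · have h1 := hge1 x (by simp)
      simp only [hg, norm_div, norm_pow, norm_mul, Complex.norm_exp]
      have e : (I * a * (x : ℂ)).re = 0 := by simp
      rw [e, Real.exp_zero, mul_one]
      exact div_le_self (norm_nonneg _) (by simpa using h1)
  have hlim : Tendsto (fun R : ℝ => ∫ x in (-R)..R, g x) atTop (𝓝 (∫ x : ℝ, g x)) :=
    intervalIntegral_tendsto_integral hgi tendsto_neg_atTop_atBot tendsto_id
  have hzero : Tendsto (fun R : ℝ => ∫ x in (-R)..R, g x) atTop (𝓝 0) := by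
    have ht : Tendsto (fun R : ℝ => (4 * M / δ ^ 2) * R⁻¹) atTop (𝓝 0) := by
      have := (tendsto_inv_atTop_zero (𝕜 := ℝ)).const_mul (4 * M / δ ^ 2)
      rwa [mul_zero] at this
    refine squeeze_zero_norm' ?_ ht
    filter_upwards [eventually_gt_atTop 0] with R hR
    have h := integral_boundary_rect_eq_zero_of_differentiableOn g (-R : ℝ) (R + R * I) (by
      intro z hz
      refine (hgd z ?_).differentiableWithinAt
      have := hz.2
      simp [Set.uIcc_of_le hR.le] at this
      exact this.1)
    have e1 : (((-R : ℝ) : ℂ)).re = -R := by simp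
    have e2 : (((-R : ℝ) : ℂ)).im = 0 := by simp
    have e3 : ((R + R * I : ℂ)).re = R := by simp
    have e4 : ((R + R * I : ℂ)).im = R := by simp
    rw [e1, e2, e3, e4] at h
    have b1 : ‖∫ x : ℝ in (-R)..R, g (x + R * I)‖ ≤ M / (δ * R) ^ 2 * |R - -R| :=
      intervalIntegral.norm_integral_le_of_norm_le_const fun x hx =>
        hgb R hR _ (by simpa using hR.le) (Or.inr (by simp))
    have b2 : ‖∫ y : ℝ in (0:ℝ)..R, g (R + y * I)‖ ≤ M / (δ * R) ^ 2 * |R - 0| :=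
      intervalIntegral.norm_integral_le_of_norm_le_const fun y hy => by
        rw [Set.uIoc_of_le hR.le] at hy
        exact hgb R hR _ (by simpa using hy.1.le) (Or.inl (by simpa using le_abs_self R))
    have b3 : ‖∫ y : ℝ in (0:ℝ)..R, g ((-R : ℝ) + y * I)‖ ≤ M / (δ * R) ^ 2 * |R - 0| :=
      intervalIntegral.norm_integral_le_of_norm_le_const fun y hy => by
        rw [Set.uIoc_of_le hR.le] at hy
        exact hgb R hR _ (by simpa using hy.1.le) (Or.inl (by simpa using le_abs_self R))
    simp only [ofReal_zero, zero_mul, add_zero, smul_eq_mul] at h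
    set A := ∫ x : ℝ in (-R)..R, g x
    set B := ∫ x : ℝ in (-R)..R, g (x + R * I)
    set D := ∫ y : ℝ in (0:ℝ)..R, g (R + y * I)
    set E := ∫ y : ℝ in (0:ℝ)..R, g ((-R : ℝ) + y * I)
    have hA : A = B - I * D + I * E := by linear_combination h
    have hn : ‖A‖ ≤ ‖B‖ + ‖D‖ + ‖E‖ := by
      rw [hA]
      refine (norm_add_le _ _).trans ?_
      refine (add_le_add_left (norm_sub_le _ _) _).trans ?_
      simp
    have r1 : |R - -R| = 2 * R := by rw [abs_of_pos] <;> linarith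
    have r2 : |R - 0| = R := by rw [sub_zero, abs_of_pos hR]
    rw [r1] at b1
    rw [r2] at b2 b3
    calc ‖A‖ ≤ M / (δ * R) ^ 2 * (2 * R) + M / (δ * R) ^ 2 * R + M / (δ * R) ^ 2 * R := by linarith
      _ = _ := by field_simp; ring
  exact tendsto_nhds_unique hlim hzero

/-- For an entire function of exponential type `τ` integrable on `ℝ` and `a > τ`,
the Fourier-type integral `∫_{-∞}^{∞} f(x) e^{iax} dx` vanishes. -/
theorem integral_exp_mul_eq_zero
    (f : ℂ → ℂ) (τ : ℝ) (hτ : 0 < τ)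
    (hf : Differentiable ℂ f)
    (htype : ∀ ε > 0, ∃ C > 0, ∀ z : ℂ, ‖f z‖ ≤ C * Real.exp ((τ + ε) * ‖z‖))
    (hint : Integrable (fun x : ℝ => f x))
    (a : ℝ) (ha : τ < a) :
    (∫ x : ℝ, f x * Complex.exp (Complex.I * (a : ℂ) * (x : ℂ))) = 0 := by
  obtain ⟨M, hM, hb⟩ := aux_bound f τ hτ hf htype hint a ha
  have hlim : Filter.Tendsto (fun n : ℕ => ∫ x : ℝ, f x * Complex.exp (Complex.I * a * x) /
      (1 - Complex.I * ((1 / ((n : ℝ) + 1) : ℝ) : ℂ) * x) ^ 2) Filter.atTop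
      (nhds (∫ x : ℝ, f x * Complex.exp (Complex.I * (a : ℂ) * (x : ℂ)))) := by
    have hge : ∀ (δ x : ℝ), 1 ≤ ‖1 - Complex.I * δ * x‖ ^ 2 := by
      intro δ x
      rw [aux_normSq]
      simp
      positivity
    refine tendsto_integral_of_dominated_convergence (fun x => ‖f x‖) ?_ hint.norm ?_ ?_
    · intro n
      refine Continuous.aestronglyMeasurable ?_
      refine Continuous.div ?_ (by fun_prop) ?_
      · exact (hf.continuous.comp Complex.continuous_ofReal).mul (by fun_prop)
      · intro x h0
        have := hge (1 / ((n : ℝ) + 1)) x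
        rw [← norm_pow, h0] at this
        norm_num at this
    · intro n
      refine Filter.Eventually.of_forall fun x => ?_
      have h1 := hge (1 / ((n : ℝ) + 1)) x
      simp only [norm_div, norm_pow, norm_mul, Complex.norm_exp]
      have e : (Complex.I * a * (x : ℂ)).re = 0 := by simp
      rw [e, Real.exp_zero, mul_one]
      exact div_le_self (norm_nonneg _) h1
    · refine Filter.Eventually.of_forall fun x => ?_
      have h0 : Filter.Tendsto (fun n : ℕ => ((1 / ((n : ℝ) + 1) : ℝ) : ℂ)) Filter.atTop (nhds 0) := by
        have := (Complex.continuous_ofReal.tendsto 0).comp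
          (tendsto_one_div_add_atTop_nhds_zero_nat (𝕜 := ℝ))
        simpa [Function.comp_def] using this
      have hc : ContinuousAt (fun d : ℂ => f x * Complex.exp (Complex.I * a * x) /
          (1 - Complex.I * d * x) ^ 2) 0 := by
        refine ContinuousAt.div (by fun_prop) (by fun_prop) (by simp)
      have := hc.tendsto.comp h0
      simpa [Function.comp_def] using this
  refine tendsto_nhds_unique hlim ?_
  have : ∀ n : ℕ, ∫ x : ℝ, f x * Complex.exp (Complex.I * a * x) /
      (1 - Complex.I * ((1 / ((n : ℝ) + 1) : ℝ) : ℂ) * x) ^ 2 = 0 := fun n =>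
    aux_delta f hf hint a M hM hb _ (by positivity)
  simp only [this]
  exact tendsto_const_nhds
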